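/- Let X be a quasi-median graph, let Y be a gated full subgraph of X, and let ℋ be a collection of hyperplanes of X. Let Y_ℋ be the full subgraph of X induced by the set of vertices v of X for which there exists a vertex p of Y such that every hyperplane separating v from p belongs to ℋ. Then Y_ℋ is a gated subgraph of X. -/

import Mathlib

namespace QM

variable {V : Type*}

/-- `y₁` and `y₂` lie (in this order) on a common geodesic from `x₁` to `x₂`. -/
def OnGeod (X : SimpleGraph V) (x₁ y₁ y₂ x₂ : V) : Prop :=
  X.dist x₁ y₁ + X.dist y₁ y₂ + X.dist y₂ x₂ = X.dist x₁ x₂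

/-- `(y₁, y₂, y₃)` is a `k`-quasi-median triple for `(x₁, x₂, x₃)` (without minimality). -/
def IsQMTriple (X : SimpleGraph V) (x₁ x₂ x₃ y₁ y₂ y₃ : V) (k : ℕ) : Prop :=
  OnGeod X x₁ y₁ y₂ x₂ ∧ OnGeod X x₁ y₁ y₃ x₃ ∧ OnGeod X x₂ y₂ y₃ x₃ ∧
    X.dist y₁ y₂ = k ∧ X.dist y₁ y₃ = k ∧ X.dist y₂ y₃ = k

/-- `y` is a quasi-median of the triple `(x₁, x₂, x₃)`: it is a `k`-quasi-median triple
with `k` as small as possible. -/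
def IsQuasiMedianTriple (X : SimpleGraph V) (x₁ x₂ x₃ : V) (y : V × V × V) : Prop :=
  ∃ k : ℕ, IsQMTriple X x₁ x₂ x₃ y.1 y.2.1 y.2.2 k ∧
    ∀ (k' : ℕ) (z₁ z₂ z₃ : V), IsQMTriple X x₁ x₂ x₃ z₁ z₂ z₃ k' → k ≤ k'

/-- The complete multipartite graph `K_{1,1,2}`: the complete graph on four vertices
with the edge between vertices `2` and `3` removed. -/
def K112 : SimpleGraph (Fin 4) :=
  SimpleGraph.fromRel (fun i j => ¬(i = 2 ∧ j = 3) ∧ ¬(i = 3 ∧ j = 2))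

/-- The 1-skeleton of the 3-cube. -/
def cubeGraph : SimpleGraph (Fin 3 → Bool) :=
  SimpleGraph.fromRel (fun x y => ∃! i, x i ≠ y i)

/-- The 6-cycle. -/
def C6 : SimpleGraph (Fin 6) := SimpleGraph.fromRel (fun i j => j = i + 1)

/-- A set of vertices is convex if it contains every vertex lying on a geodesic between
two of its members. -/
def IsConvexSet (X : SimpleGraph V) (S : Set V) : Prop :=
  ∀ x ∈ S, ∀ y ∈ S, ∀ z : V, X.dist x z + X.dist z y = X.dist x y → z ∈ S

/-- The convex hull of a set of vertices. -/
def convexHullSet (X : SimpleGraph V) (S : Set V) : Set V :=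
  ⋂₀ {T : Set V | S ⊆ T ∧ IsConvexSet X T}

/-- A quasi-median graph: a connected graph in which every triple of vertices has a unique
quasi-median, with no induced `K_{1,1,2}`, and in which the convex hull of every isometrically
embedded 6-cycle is isomorphic to the 3-cube. -/
structure IsQuasiMedian (X : SimpleGraph V) : Prop where
  connected : X.Connected
  uniqueQuasiMedian : ∀ x₁ x₂ x₃ : V, ∃! y : V × V × V, IsQuasiMedianTriple X x₁ x₂ x₃ y
  noK112 : IsEmpty (SimpleGraph.Embedding K112 X)
  hullOfC6IsCube : ∀ f : Fin 6 → V,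
    (∀ i j, C6.Adj i j → X.Adj (f i) (f j)) →
    (∀ i j, X.dist (f i) (f j) = C6.dist i j) →
    Nonempty (SimpleGraph.Iso
      (SimpleGraph.induce (convexHullSet X (Set.range f)) X) cubeGraph)

/-- Two edges are two sides of a common triangle, or opposite sides of a common square. -/
def SideRel (X : SimpleGraph V) (e f : Sym2 V) : Prop :=
  (∃ a b c : V, X.Adj a b ∧ X.Adj a c ∧ X.Adj b c ∧ e = s(a, b) ∧ f = s(a, c)) ∨
  (∃ a b c d : V, X.Adj a b ∧ X.Adj c d ∧ X.Adj a c ∧ X.Adj b d ∧ a ≠ d ∧ b ≠ c ∧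
    e = s(a, b) ∧ f = s(c, d))

/-- The equivalence class of an edge under the equivalence relation generated by `SideRel`. -/
def hypClass (X : SimpleGraph V) (e : Sym2 V) : Set (Sym2 V) :=
  {f | Relation.EqvGen (SideRel X) e f}

/-- A hyperplane: the equivalence class of some edge of `X`. -/
def IsHyperplane (X : SimpleGraph V) (H : Set (Sym2 V)) : Prop :=
  ∃ e ∈ X.edgeSet, H = hypClass X e

/-- The type of hyperplanes of `X`. -/
def Hyperplane (X : SimpleGraph V) := {H : Set (Sym2 V) // IsHyperplane X H}

/-- Edges `e`, `e'` sharing the endpoint `p`, not lying in a common clique, that are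
adjacent sides of a square of `X`: their dual hyperplanes intersect at `p`. -/
def IntersectAt (X : SimpleGraph V) (e e' : Sym2 V) (p : V) : Prop :=
  ∃ a b : V, e = s(p, a) ∧ e' = s(p, b) ∧ X.Adj p a ∧ X.Adj p b ∧ a ≠ b ∧ ¬ X.Adj a b ∧
    ∃ q : V, q ≠ p ∧ X.Adj a q ∧ X.Adj b q

/-- Edges `e`, `e'` sharing the endpoint `p`, not lying in a common clique, and not adjacent
sides of any square of `X`: their dual hyperplanes osculate at `p`. -/
def OsculateAt (X : SimpleGraph V) (e e' : Sym2 V) (p : V) : Prop :=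
  ∃ a b : V, e = s(p, a) ∧ e' = s(p, b) ∧ X.Adj p a ∧ X.Adj p b ∧ a ≠ b ∧ ¬ X.Adj a b ∧
    ¬ ∃ q : V, q ≠ p ∧ X.Adj a q ∧ X.Adj b q

/-- Hyperplanes `H` and `H'` intersect at `p`. -/
def HypIntersectAt (X : SimpleGraph V) (H H' : Hyperplane X) (p : V) : Prop :=
  ∃ e ∈ H.1, ∃ e' ∈ H'.1, IntersectAt X e e' p

/-- Hyperplanes `H` and `H'` osculate at `p`. -/
def HypOsculateAt (X : SimpleGraph V) (H H' : Hyperplane X) (p : V) : Prop :=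
  ∃ e ∈ H.1, ∃ e' ∈ H'.1, OsculateAt X e e' p

/-- Hyperplanes `H` and `H'` intersect. -/
def HypIntersect (X : SimpleGraph V) (H H' : Hyperplane X) : Prop :=
  ∃ p : V, HypIntersectAt X H H' p

/-- Hyperplanes `H` and `H'` osculate. -/
def HypOsculate (X : SimpleGraph V) (H H' : Hyperplane X) : Prop :=
  ∃ p : V, HypOsculateAt X H H' p

/-- The contact graph `𝒞X`: hyperplanes are adjacent iff they intersect or osculate. -/
def contactGraph (X : SimpleGraph V) : SimpleGraph (Hyperplane X) :=
  SimpleGraph.fromRel (fun H H' => HypIntersect X H H' ∨ HypOsculate X H H')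

/-- The crossing graph `ΔX`: hyperplanes are adjacent iff they intersect. -/
def crossingGraph (X : SimpleGraph V) : SimpleGraph (Hyperplane X) :=
  SimpleGraph.fromRel (fun H H' => HypIntersect X H H')

/-- The (vertex set of the) carrier of a hyperplane: all endpoints of its edges. -/
def hypCarrier (X : SimpleGraph V) (H : Hyperplane X) : Set V :=
  {v : V | ∃ e ∈ H.1, v ∈ e}

/-- A set of edges `H` (e.g. a hyperplane) separates `p` from `q` if every walk from `p`
to `q` uses an edge of `H`. -/
def Separates (X : SimpleGraph V) (H : Set (Sym2 V)) (p q : V) : Prop :=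
  ∀ w : X.Walk p q, ∃ e ∈ w.edges, e ∈ H

/-- `f` is a `(λ, c)`-quasi-isometry from `(A, dA)` to `(B, dB)`. -/
def IsQuasiIsometry {A B : Type*} (lam c : ℝ) (dA : A → A → ℝ) (dB : B → B → ℝ)
    (f : A → B) : Prop :=
  (∀ x y : A, dA x y / lam - c ≤ dB (f x) (f y) ∧ dB (f x) (f y) ≤ lam * dA x y + c) ∧
    ∀ b : B, ∃ a : A, dB (f a) b ≤ c

end QM

namespace QM

/-- `p` is a gate for `v` in the (full subgraph spanned by the) vertex set `S`. -/
def IsGate {V : Type*} (X : SimpleGraph V) (S : Set V) (v p : V) : Prop :=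
  p ∈ S ∧ ∀ q ∈ S, X.dist v p + X.dist p q = X.dist v q

/-- The (full subgraph spanned by the) vertex set `S` is gated. -/
def IsGated {V : Type*} (X : SimpleGraph V) (S : Set V) : Prop :=
  ∀ v : V, ∃ p : V, IsGate X S v p

/-- `Y_ℋ`: the set of vertices `v` admitting a vertex `p` of `Y` such that every hyperplane
separating `v` from `p` lies in `ℋ`. -/
def gatedExtension {V : Type*} (X : SimpleGraph V) (S : Set V)
    (ℋ : Set (Hyperplane X)) : Set V :=
  {v : V | ∃ p ∈ S, ∀ H : Hyperplane X, Separates X H.1 v p → H ∈ ℋ}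

/-! ### Distances in connected graphs -/

section Distance

variable {V : Type*} {X : SimpleGraph V}

theorem dist_le_of_adj (hc : X.Connected) {a b : V} (h : X.Adj a b) (u : V) :
    X.dist u a ≤ X.dist u b + 1 := by
  have h1 := hc.dist_triangle (u := u) (v := b) (w := a)
  rwa [SimpleGraph.dist_eq_one_iff_adj.2 h.symm] at h1

theorem exists_adj_dist_eq (hc : X.Connected) {u v : V} {k : ℕ} (h : X.dist u v = k + 1) :
    ∃ w, X.Adj w v ∧ X.dist u w = k := by
  obtain ⟨p, hp⟩ := hc.exists_walk_length_eq_dist v u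
  rw [SimpleGraph.dist_comm, h] at hp
  cases p with
  | nil => simp at hp
  | @cons _ w _ hvw p =>
    refine ⟨w, hvw.symm, ?_⟩
    have h1 := SimpleGraph.dist_le p
    have h2 := dist_le_of_adj hc hvw u
    rw [SimpleGraph.dist_comm] at h1
    simp only [SimpleGraph.Walk.length_cons] at hp
    omega

theorem two_le_dist (hc : X.Connected) {a b : V} (hne : a ≠ b) (hna : ¬ X.Adj a b) :
    2 ≤ X.dist a b := by
  have h0 : X.dist a b ≠ 0 := fun h => hne (hc.dist_eq_zero_iff.1 h)
  have h1 : X.dist a b ≠ 1 := fun h => hna (SimpleGraph.dist_eq_one_iff_adj.1 h)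
  omega

theorem exists_common_neighbor (hc : X.Connected) {a b : V} (h : X.dist a b = 2) :
    ∃ c, X.Adj a c ∧ X.Adj c b := by
  obtain ⟨c, hcb, hac⟩ := exists_adj_dist_eq hc h
  exact ⟨c, SimpleGraph.dist_eq_one_iff_adj.1 hac, hcb⟩

theorem dist_eq_two (hc : X.Connected) {a b c : V} (hne : a ≠ b) (hna : ¬ X.Adj a b)
    (hac : X.Adj a c) (hcb : X.Adj c b) : X.dist a b = 2 := by
  have h1 := two_le_dist hc hne hna
  have h2 := dist_le_of_adj hc hcb.symm a
  have h3 := SimpleGraph.dist_eq_one_iff_adj.2 hac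
  omega

theorem exists_nearest (S : Set V) (hS : S.Nonempty) (v : V) :
    ∃ p ∈ S, ∀ q ∈ S, X.dist v p ≤ X.dist v q := by
  obtain ⟨p, hp, h⟩ := WellFounded.has_min (measure (X.dist v)).wf S hS
  exact ⟨p, hp, fun q hq => not_lt.1 (h q hq)⟩

end Distance

/-! ### The 6-cycle and the 3-cube -/

theorem C6_connected : C6.Connected := by
  have hstep : ∀ i : Fin 6, C6.Adj i (i + 1) := by
    intro i
    simp only [C6, SimpleGraph.fromRel_adj]
    revert i
    decide
  refine SimpleGraph.connected_iff_exists_forall_reachable _ |>.2 ⟨0, ?_⟩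
  have h0 : C6.Reachable 0 0 := SimpleGraph.Reachable.refl _
  have h1 := h0.trans (hstep 0).reachable
  have h2 := h1.trans (hstep 1).reachable
  have h3 := h2.trans (hstep 2).reachable
  have h4 := h3.trans (hstep 3).reachable
  have h5 := h4.trans (hstep 4).reachable
  intro i
  fin_cases i <;> assumption

theorem C6_adj_iff (i j : Fin 6) : C6.Adj i j ↔ j = i + 1 ∨ i = j + 1 := by
  simp only [C6, SimpleGraph.fromRel_adj]
  revert i j
  decide

theorem C6_dist_self_add_one (i : Fin 6) : C6.dist i (i + 1) = 1 :=
  SimpleGraph.dist_eq_one_iff_adj.2 ((C6_adj_iff _ _).2 (Or.inl rfl))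

theorem C6_dist_self_add_two (i : Fin 6) : C6.dist i (i + 2) = 2 := by
  refine dist_eq_two C6_connected (c := i + 1) ?_ ?_ ?_ ?_ <;>
    try rw [C6_adj_iff]
  all_goals revert i; decide

theorem C6_dist_self_add_three (i : Fin 6) : C6.dist i (i + 3) = 3 := by
  have h1 : 2 ≤ C6.dist i (i + 3) := by
    refine two_le_dist C6_connected ?_ ?_ <;> try rw [C6_adj_iff]
    all_goals revert i; decide
  have h2 : C6.dist i (i + 3) ≠ 2 := by
    intro h
    obtain ⟨c, hc, hc'⟩ := exists_common_neighbor C6_connected h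
    rw [C6_adj_iff] at hc hc'
    clear h h1
    revert i c
    decide
  have h3 := dist_le_of_adj C6_connected (a := i + 3) (b := i + 2)
    (by rw [C6_adj_iff]; clear h1 h2; revert i; decide) i
  rw [C6_dist_self_add_two] at h3
  omega

theorem C6_dist_eq {V : Type*} {X : SimpleGraph V} (f : Fin 6 → V)
    (h1 : ∀ i, X.dist (f i) (f (i + 1)) = 1) (h2 : ∀ i, X.dist (f i) (f (i + 2)) = 2)
    (h3 : ∀ i, X.dist (f i) (f (i + 3)) = 3) (i j : Fin 6) :
    X.dist (f i) (f j) = C6.dist i j := by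
  have hij : j = i ∨ j = i + 1 ∨ j = i + 2 ∨ j = i + 3 ∨ i = j + 2 ∨ i = j + 1 := by
    revert i j
    decide
  rcases hij with rfl | rfl | rfl | rfl | rfl | rfl
  · simp
  · rw [h1, C6_dist_self_add_one]
  · rw [h2, C6_dist_self_add_two]
  · rw [h3, C6_dist_self_add_three]
  · rw [SimpleGraph.dist_comm, h2, SimpleGraph.dist_comm, C6_dist_self_add_two]
  · rw [SimpleGraph.dist_comm, h1, SimpleGraph.dist_comm, C6_dist_self_add_one]

/-- The parity of a vertex of the 3-cube. -/
def cubeParity (x : Fin 3 → Bool) : Bool := xor (x 0) (xor (x 1) (x 2))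

theorem cubeGraph_adj_iff (x y : Fin 3 → Bool) :
    cubeGraph.Adj x y ↔
      (x 0 ≠ y 0 ∧ x 1 = y 1 ∧ x 2 = y 2) ∨ (x 0 = y 0 ∧ x 1 ≠ y 1 ∧ x 2 = y 2) ∨
        (x 0 = y 0 ∧ x 1 = y 1 ∧ x 2 ≠ y 2) := by
  simp only [cubeGraph, SimpleGraph.fromRel_adj, ExistsUnique, Fin.exists_fin_succ,
    Fin.forall_fin_succ, ne_eq, funext_iff]
  simp
  generalize x 0 = a, x 1 = b, x 2 = c, y 0 = d, y 1 = e, y 2 = f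
  revert a b c d e f
  decide

theorem cubeParity_ne_of_adj {x y : Fin 3 → Bool} (h : cubeGraph.Adj x y) :
    cubeParity x = !cubeParity y := by
  rw [cubeGraph_adj_iff] at h
  unfold cubeParity
  generalize x 0 = a, x 1 = b, x 2 = c, y 0 = d, y 1 = e, y 2 = f at *
  revert a b c d e f
  decide

set_option synthInstance.maxSize 2000 in
set_option synthInstance.maxHeartbeats 400000 in
theorem exists_cubeGraph_common_neighbor {x y z : Fin 3 → Bool} (hxy : x ≠ y) (hxz : x ≠ z)
    (hyz : y ≠ z) (hpxy : cubeParity x = cubeParity y) (hpxz : cubeParity x = cubeParity z) :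
    ∃ m, cubeGraph.Adj x m ∧ cubeGraph.Adj y m ∧ cubeGraph.Adj z m := by
  refine ⟨fun i => (x i && y i) || (x i && z i) || (y i && z i), ?_⟩
  simp only [cubeGraph_adj_iff]
  simp only [ne_eq, funext_iff, Fin.forall_fin_succ] at hxy hxz hyz
  simp at hxy hxz hyz
  unfold cubeParity at hpxy hpxz
  generalize x 0 = a, x 1 = b, x 2 = c, y 0 = d, y 1 = e, y 2 = f, z 0 = g, z 1 = h,
    z 2 = i at *
  revert a b c d e f g h i
  decide

/-! ### Weak modularity and forbidden subgraphs -/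

section QuasiMedian

variable {V : Type*} {X : SimpleGraph V}

theorem IsQuasiMedian.exists_triple (hX : IsQuasiMedian X) (x₁ x₂ x₃ : V) :
    ∃ k y₁ y₂ y₃, IsQMTriple X x₁ x₂ x₃ y₁ y₂ y₃ k ∧
      ∀ (k' : ℕ) (z₁ z₂ z₃ : V), IsQMTriple X x₁ x₂ x₃ z₁ z₂ z₃ k' → k ≤ k' := by
  obtain ⟨⟨y₁, y₂, y₃⟩, ⟨k, h⟩, -⟩ := hX.uniqueQuasiMedian x₁ x₂ x₃
  exact ⟨k, y₁, y₂, y₃, h⟩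

/-- A vertex lying between any two of `x₁`, `x₂`, `x₃` gives a `0`-quasi-median. -/
theorem isQMTriple_zero {x₁ x₂ x₃ m : V} (h₁₂ : X.dist x₁ m + X.dist x₂ m = X.dist x₁ x₂)
    (h₁₃ : X.dist x₁ m + X.dist x₃ m = X.dist x₁ x₃)
    (h₂₃ : X.dist x₂ m + X.dist x₃ m = X.dist x₂ x₃) : IsQMTriple X x₁ x₂ x₃ m m m 0 := by
  rw [X.dist_comm (u := x₃)] at h₁₃ h₂₃
  rw [X.dist_comm (u := x₂)] at h₁₂
  exact ⟨by simpa [OnGeod] using h₁₂, by simpa [OnGeod] using h₁₃, by simpa [OnGeod] using h₂₃,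
    by simp⟩

/-- The triangle condition. -/
theorem IsQuasiMedian.triangle (hX : IsQuasiMedian X) {u v w : V} (hvw : X.Adj v w)
    (h : X.dist u v = X.dist u w) :
    ∃ x, X.Adj x v ∧ X.Adj x w ∧ X.dist u x + 1 = X.dist u v := by
  have hc := hX.connected
  obtain ⟨k, y₁, y₂, y₃, ⟨h12, h13, h23, e12, e13, e23⟩, -⟩ := hX.exists_triple u v w
  unfold OnGeod at h12 h13 h23
  rw [SimpleGraph.dist_eq_one_iff_adj.2 hvw] at h23
  have t1 := hc.dist_triangle (u := u) (v := y₁) (w := v)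
  have c := X.dist_comm (u := v) (v := y₂)
  have c3 := X.dist_comm (u := w) (v := y₃)
  have hk : k = 1 := by
    by_contra hk
    omega
  have hv : y₂ = v := hc.dist_eq_zero_iff.1 (by omega)
  have hw : y₃ = w := hc.dist_eq_zero_iff.1 (by omega)
  subst hv hw hk
  refine ⟨y₁, SimpleGraph.dist_eq_one_iff_adj.1 e12, SimpleGraph.dist_eq_one_iff_adj.1 e13, ?_⟩
  simp at h12
  omega

theorem IsQuasiMedian.adj_of_common_edge (hX : IsQuasiMedian X) {a b c d : V} (hab : X.Adj a b)
    (hac : X.Adj a c) (hbc : X.Adj b c) (had : X.Adj a d) (hbd : X.Adj b d) (hcd : c ≠ d) :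
    X.Adj c d := by
  by_contra hn
  refine hX.noK112.false ⟨⟨![a, b, c, d], ?_⟩, ?_⟩
  · intro i j
    fin_cases i <;> fin_cases j <;>
      simp [hab.ne, hac.ne, hbc.ne, had.ne, hbd.ne, hcd, hab.ne', hac.ne', hbc.ne', had.ne',
        hbd.ne', hcd.symm]
  · intro i j
    have hn' : ¬ X.Adj d c := fun h => hn h.symm
    change X.Adj (![a, b, c, d] i) (![a, b, c, d] j) ↔ K112.Adj i j
    fin_cases i <;> fin_cases j <;>
      simp [K112, hab, hac, hbc, had, hbd, hn, hn', hab.symm, hac.symm, hbc.symm, had.symm,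
        hbd.symm]

/-- Two adjacent vertices at the same distance from `u` have no common neighbor farther away. -/
theorem IsQuasiMedian.false_of_level_edge (hX : IsQuasiMedian X) {u x w z : V}
    (hxw : X.Adj x w) (hzx : X.Adj z x) (hzw : X.Adj z w) (h : X.dist u x = X.dist u w)
    (hz : X.dist u z = X.dist u x + 1) : False := by
  obtain ⟨t, htx, htw, ht⟩ := hX.triangle hxw h
  have hne : t ≠ z := by
    rintro rfl
    omega
  have := dist_le_of_adj hX.connected
    (hX.adj_of_common_edge hxw htx.symm htw.symm hzx.symm hzw.symm hne).symm u
  omega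

/-- Three alternate vertices of an isometric hexagon have a common neighbor. -/
theorem IsQuasiMedian.exists_center_of_hexagon (hX : IsQuasiMedian X) (f : Fin 6 → V)
    (h1 : ∀ i, X.dist (f i) (f (i + 1)) = 1) (h2 : ∀ i, X.dist (f i) (f (i + 2)) = 2)
    (h3 : ∀ i, X.dist (f i) (f (i + 3)) = 3) :
    ∃ m, X.Adj (f 1) m ∧ X.Adj (f 3) m ∧ X.Adj (f 5) m := by
  have hadj : ∀ i, X.Adj (f i) (f (i + 1)) := fun i => SimpleGraph.dist_eq_one_iff_adj.1 (h1 i)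
  have hd := C6_dist_eq f h1 h2 h3
  obtain ⟨φ⟩ := hX.hullOfC6IsCube f (fun i j hij => by
    rw [← SimpleGraph.dist_eq_one_iff_adj, hd, SimpleGraph.dist_eq_one_iff_adj]
    exact hij) hd
  have hmem : ∀ i, f i ∈ convexHullSet X (Set.range f) :=
    fun i => Set.mem_sInter.2 fun T hT => hT.1 ⟨i, rfl⟩
  let g : Fin 6 → (convexHullSet X (Set.range f)) := fun i => ⟨f i, hmem i⟩
  have hg : ∀ i, cubeParity (φ (g i)) = !cubeParity (φ (g (i + 1))) := fun i =>
    cubeParity_ne_of_adj (φ.map_rel_iff.2 (hadj i))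
  have hne : ∀ i, φ (g i) ≠ φ (g (i + 2)) := by
    intro i h
    have h' : f i = f (i + 2) := congrArg Subtype.val (φ.injective h)
    have := h2 i
    rw [← h'] at this
    simp at this
  have hp : ∀ i, cubeParity (φ (g i)) = cubeParity (φ (g (i + 2))) := by
    intro i
    have e : i + 1 + 1 = i + 2 := by
      revert i
      decide
    rw [hg i, hg (i + 1), e, Bool.not_not]
  obtain ⟨m, m1, m3, m5⟩ := exists_cubeGraph_common_neighbor (hne 1) (hne 5).symm (hne 3) (hp 1)
    (hp 5).symm
  obtain ⟨m', rfl⟩ := φ.surjective m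
  exact ⟨m', φ.map_rel_iff.1 m1, φ.map_rel_iff.1 m3, φ.map_rel_iff.1 m5⟩

/-- The quadrangle condition. -/
theorem IsQuasiMedian.quadrangle (hX : IsQuasiMedian X) {u v w z : V} (hzv : X.Adj z v)
    (hzw : X.Adj z w) (hvw : ¬ X.Adj v w) (hne : v ≠ w) (hv : X.dist u v + 1 = X.dist u z)
    (hw : X.dist u w + 1 = X.dist u z) :
    ∃ x, X.Adj x v ∧ X.Adj x w ∧ X.dist u x + 1 = X.dist u v := by
  have hc := hX.connected
  have dvw := dist_eq_two hc hne hvw hzv.symm hzw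
  have key : ∀ p v w : V, X.Adj z v → X.Adj z w → X.dist u v + 1 = X.dist u z →
      X.dist u w + 1 = X.dist u z → ¬ X.Adj v w → X.Adj v p → X.dist u p + 1 = X.dist u v →
      X.dist p w ≠ 2 := by
    intro p v w hzv hzw hv hw hvw hvp hp hpw
    have hzp : X.dist p z = 2 := by
      refine dist_eq_two hc ?_ ?_ hvp.symm hzv.symm
      · rintro rfl
        omega
      · intro h
        have := dist_le_of_adj hc h.symm u
        omega
    obtain ⟨s, hsz, hsw, hs⟩ := hX.triangle hzw (hzp.trans hpw.symm)
    have hps : X.Adj p s := SimpleGraph.dist_eq_one_iff_adj.1 (by omega)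
    have a1 := dist_le_of_adj hc hps.symm u
    have a2 := dist_le_of_adj hc hsz.symm u
    exact hX.false_of_level_edge (u := u) hsw hsz.symm hzw (by omega) (by omega)
  by_contra hcon
  push Not at hcon
  obtain ⟨k, y₁, y₂, y₃, ⟨h12, h13, h23, e12, e13, e23⟩, -⟩ := hX.exists_triple u v w
  unfold OnGeod at h12 h13 h23
  have c := X.dist_comm (u := v) (v := y₂)
  have c3 := X.dist_comm (u := w) (v := y₃)
  have hk : k = 0 ∨ k = 2 := by omega
  rcases hk with rfl | rfl
  · have e : y₁ = y₂ := hc.dist_eq_zero_iff.1 e12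
    have e' : y₁ = y₃ := hc.dist_eq_zero_iff.1 e13
    subst e e'
    exact hcon y₁ (SimpleGraph.dist_eq_one_iff_adj.1 (by omega))
      (SimpleGraph.dist_eq_one_iff_adj.1 (by omega)) (by omega)
  · have ev : y₂ = v := hc.dist_eq_zero_iff.1 (by omega)
    have ew : y₃ = w := hc.dist_eq_zero_iff.1 (by omega)
    subst ev ew
    simp only [SimpleGraph.dist_self] at h12 h13
    obtain ⟨p, hpv, hp⟩ := exists_adj_dist_eq hc (u := y₁) (v := y₂) (k := 1) (by omega)
    obtain ⟨q, hqw, hq⟩ := exists_adj_dist_eq hc (u := y₁) (v := y₃) (k := 1) (by omega)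
    have hyp : X.Adj y₁ p := SimpleGraph.dist_eq_one_iff_adj.1 hp
    have hyq : X.Adj y₁ q := SimpleGraph.dist_eq_one_iff_adj.1 hq
    have up1 := dist_le_of_adj hc hyp.symm u
    have up2 := dist_le_of_adj hc hpv.symm u
    have uq1 := dist_le_of_adj hc hyq.symm u
    have uq2 := dist_le_of_adj hc hqw.symm u
    have zp : X.dist z p = 2 := by
      refine dist_eq_two hc ?_ ?_ hzv hpv.symm
      · rintro rfl
        omega
      · intro h
        have := dist_le_of_adj hc h u
        omega
    have zq : X.dist z q = 2 := by
      refine dist_eq_two hc ?_ ?_ hzw hqw.symm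
      · rintro rfl
        omega
      · intro h
        have := dist_le_of_adj hc h u
        omega
    have pw2 := key p y₂ y₃ hzv hzw hv hw hvw hpv.symm (by omega)
    have qv2 := key q y₃ y₂ hzw hzv hw hv (fun h => hvw h.symm) hqw.symm (by omega)
    have pw' := two_le_dist hc (a := p) (b := y₃) (by rintro rfl; omega)
      (fun h => hcon p hpv h (by omega))
    have qv' := two_le_dist hc (a := q) (b := y₂) (by rintro rfl; omega)
      (fun h => hcon q h hqw (by omega))
    have pw3 := dist_le_of_adj hc hzw.symm p
    have qv3 := dist_le_of_adj hc hzv.symm q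
    rw [SimpleGraph.dist_comm] at zp zq
    have pq2 : X.dist p q = 2 := by
      refine dist_eq_two hc ?_ ?_ hyp.symm hyq
      · rintro rfl
        exact hcon p hpv hqw (by omega)
      · intro h
        have := dist_le_of_adj hc hqw.symm p
        rw [SimpleGraph.dist_eq_one_iff_adj.2 h] at this
        omega
    have zy1 := dist_le_of_adj hc hyp z
    have zy2 : X.dist u z ≤ X.dist u y₁ + X.dist y₁ z := hc.dist_triangle
    rw [X.dist_comm (u := y₁) (v := z)] at zy2
    have cz := X.dist_comm (u := p) (v := z)
    have cy := X.dist_comm (u := y₁) (v := z)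
    have cp := X.dist_comm (u := p) (v := y₃)
    have cq := X.dist_comm (u := q) (v := y₂)
    have cv := X.dist_comm (u := y₁) (v := y₂)
    have cvw := X.dist_comm (u := y₂) (v := y₃)
    have cyp := X.dist_comm (u := p) (v := y₁)
    have cpv := X.dist_comm (u := p) (v := y₂)
    have czw := X.dist_comm (u := z) (v := y₃)
    have d1 := SimpleGraph.dist_eq_one_iff_adj.2 hzv
    have d2 := SimpleGraph.dist_eq_one_iff_adj.2 hpv
    have d3 := SimpleGraph.dist_eq_one_iff_adj.2 hqw
    have d4 := SimpleGraph.dist_eq_one_iff_adj.2 hzw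
    have vp1 : X.dist y₂ p = 1 := by omega
    have py1 : X.dist p y₁ = 1 := by omega
    have wz1 : X.dist y₃ z = 1 := by omega
    have zp2 : X.dist z p = 2 := by omega
    have vy2 : X.dist y₂ y₁ = 2 := by omega
    have yw2 : X.dist y₁ y₃ = 2 := by omega
    have qz2 : X.dist q z = 2 := by omega
    have wv2 : X.dist y₃ y₂ = 2 := by omega
    have z3 : X.dist z y₁ = 3 := by omega
    have v3 : X.dist y₂ q = 3 := by omega
    have p3 : X.dist p y₃ = 3 := by omega
    have y3' : X.dist y₁ z = 3 := by omega
    have q3 : X.dist q y₂ = 3 := by omega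
    have w3 : X.dist y₃ p = 3 := by omega
    obtain ⟨m, m1, m3, m5⟩ := hX.exists_center_of_hexagon ![z, y₂, p, y₁, q, y₃]
      (by intro i; fin_cases i; exacts [d1, vp1, py1, hq, d3, wz1])
      (by intro i; fin_cases i; exacts [zp2, vy2, pq2, yw2, qz2, wv2])
      (by intro i; fin_cases i; exacts [z3, v3, p3, y3', q3, w3])
    change X.Adj y₂ m at m1
    change X.Adj y₁ m at m3
    change X.Adj y₃ m at m5
    have um1 := dist_le_of_adj hc m3.symm u
    have um2 := dist_le_of_adj hc m1 u
    exact hcon m m1.symm m5.symm (by omega)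

/-- There is no induced `K_{2,3}`. -/
theorem IsQuasiMedian.eq_of_common_neighbors (hX : IsQuasiMedian X) {a b x y z : V}
    (hax : X.Adj x a) (hay : X.Adj y a) (haz : X.Adj z a) (hbx : X.Adj x b) (hby : X.Adj y b)
    (hbz : X.Adj z b) (hxy : X.dist x y = 2) (hxz : X.dist x z = 2) (hyz : X.dist y z = 2) :
    a = b := by
  have key : ∀ m, X.Adj x m → X.Adj y m → X.Adj z m →
      IsQuasiMedianTriple X x y z (m, m, m) := by
    intro m hx hy hz
    rw [← SimpleGraph.dist_eq_one_iff_adj] at hx hy hz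
    exact ⟨0, isQMTriple_zero (m := m) (by omega) (by omega) (by omega),
      fun _ _ _ _ _ => Nat.zero_le _⟩
  exact congrArg Prod.fst
    ((hX.uniqueQuasiMedian x y z).unique (key a hax hay haz) (key b hbx hby hbz))

/-! ### Maximal cliques and parallel edges -/

/-- The set of vertices equal or adjacent to both `a` and `b`; for an edge of a quasi-median
graph, this is the maximal clique containing it. -/
def edgeClique (X : SimpleGraph V) (a b : V) : Set V :=
  {c | c = a ∨ c = b ∨ X.Adj a c ∧ X.Adj b c}

theorem left_mem_edgeClique (a b : V) : a ∈ edgeClique X a b := Or.inl rfl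

theorem right_mem_edgeClique (a b : V) : b ∈ edgeClique X a b := Or.inr (Or.inl rfl)

theorem IsQuasiMedian.adj_of_mem_edgeClique (hX : IsQuasiMedian X) {a b c d : V}
    (hab : X.Adj a b) (hc : c ∈ edgeClique X a b) (hd : d ∈ edgeClique X a b) (hcd : c ≠ d) :
    X.Adj c d := by
  rcases hc with rfl | rfl | ⟨h1, h2⟩ <;> rcases hd with rfl | rfl | ⟨h3, h4⟩
  · exact absurd rfl hcd
  · exact hab
  · exact h3
  · exact hab.symm
  · exact absurd rfl hcd
  · exact h4
  · exact h1.symm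
  · exact h2.symm
  · exact hX.adj_of_common_edge hab h1 h2 h3 h4 hcd

theorem IsQuasiMedian.mem_edgeClique (hX : IsQuasiMedian X) {a b c d e : V} (hab : X.Adj a b)
    (hc : c ∈ edgeClique X a b) (hd : d ∈ edgeClique X a b) (hec : X.Adj e c) (hed : X.Adj e d)
    (hcd : c ≠ d) : e ∈ edgeClique X a b := by
  have hcd' := hX.adj_of_mem_edgeClique hab hc hd hcd
  have key : ∀ x ∈ edgeClique X a b, e = x ∨ X.Adj x e := by
    intro x hx
    by_cases hxc : x = c
    · exact Or.inr (hxc ▸ hec.symm)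
    by_cases hxd : x = d
    · exact Or.inr (hxd ▸ hed.symm)
    by_cases hxe : e = x
    · exact Or.inl hxe
    exact Or.inr (hX.adj_of_common_edge hcd' (hX.adj_of_mem_edgeClique hab hc hx (Ne.symm hxc))
      (hX.adj_of_mem_edgeClique hab hd hx (Ne.symm hxd)) hec.symm hed.symm (Ne.symm hxe))
  rcases key a (left_mem_edgeClique a b) with h | h
  · exact Or.inl h
  rcases key b (right_mem_edgeClique a b) with h' | h'
  · exact Or.inr (Or.inl h')
  exact Or.inr (Or.inr ⟨h, h'⟩)

theorem IsQuasiMedian.isGate_edgeClique (hX : IsQuasiMedian X) {a b v c : V} (hab : X.Adj a b)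
    (hc : c ∈ edgeClique X a b) (h : ∀ d ∈ edgeClique X a b, X.dist v c ≤ X.dist v d) :
    IsGate X (edgeClique X a b) v c := by
  refine ⟨hc, fun d hd => ?_⟩
  by_cases hcd : c = d
  · simp [hcd]
  have hadj := hX.adj_of_mem_edgeClique hab hc hd hcd
  have h1 := dist_le_of_adj hX.connected hadj.symm v
  have h2 := h d hd
  rw [SimpleGraph.dist_eq_one_iff_adj.2 hadj]
  by_contra hne
  obtain ⟨x, hxc, hxd, hx⟩ := hX.triangle (u := v) hadj (by omega)
  have := h x (hX.mem_edgeClique hab hc hd hxc hxd hcd)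
  omega

theorem IsQuasiMedian.isGated_edgeClique (hX : IsQuasiMedian X) {a b : V} (hab : X.Adj a b) :
    IsGated X (edgeClique X a b) := by
  intro v
  obtain ⟨c, hc, h⟩ := exists_nearest (X := X) (edgeClique X a b) ⟨a, left_mem_edgeClique a b⟩ v
  exact ⟨c, hX.isGate_edgeClique hab hc h⟩

theorem IsQuasiMedian.dist_eq_of_isGate_edgeClique (hX : IsQuasiMedian X) {a b v c d : V}
    (hab : X.Adj a b) (hc : IsGate X (edgeClique X a b) v c) (hd : d ∈ edgeClique X a b)
    (hcd : c ≠ d) : X.dist v d = X.dist v c + 1 := by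
  rw [← hc.2 d hd, SimpleGraph.dist_eq_one_iff_adj.2 (hX.adj_of_mem_edgeClique hab hc.1 hd hcd)]

theorem IsGate.eq (hc : X.Connected) {S : Set V} {v p q : V} (hp : IsGate X S v p)
    (hq : IsGate X S v q) : p = q := by
  have h1 := hp.2 q hq.1
  have h2 := hq.2 p hp.1
  exact hc.dist_eq_zero_iff.1 (by omega)

/-- Adjacent vertices with different gates in a clique are equidistant from it. -/
theorem IsQuasiMedian.dist_gate_eq (hX : IsQuasiMedian X) {a b x y c d : V} (hab : X.Adj a b)
    (hxy : X.Adj x y) (hc : IsGate X (edgeClique X a b) x c)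
    (hd : IsGate X (edgeClique X a b) y d) (hcd : c ≠ d) : X.dist x c = X.dist y d := by
  have h1 := hX.dist_eq_of_isGate_edgeClique hab hc hd.1 hcd
  have h2 := hX.dist_eq_of_isGate_edgeClique hab hd hc.1 hcd.symm
  have h3 := dist_le_of_adj hX.connected hxy c
  have h4 := dist_le_of_adj hX.connected hxy.symm d
  simp only [X.dist_comm (u := c), X.dist_comm (u := d)] at h3 h4
  have h5 := dist_le_of_adj hX.connected hxy.symm c
  have h6 := dist_le_of_adj hX.connected hxy d
  simp only [X.dist_comm (u := c), X.dist_comm (u := d)] at h5 h6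
  omega

theorem SideRel.symm {e f : Sym2 V} (h : SideRel X e f) : SideRel X f e := by
  rcases h with ⟨a, b, c, hab, hac, hbc, rfl, rfl⟩ | ⟨a, b, c, d, hab, hcd, hac, hbd, h1, h2,
    rfl, rfl⟩
  · exact Or.inl ⟨a, c, b, hac, hab, hbc.symm, rfl, rfl⟩
  · exact Or.inr ⟨c, d, a, b, hcd, hab, hac.symm, hbd.symm, h2.symm, h1.symm, rfl, rfl⟩

theorem IsQuasiMedian.eqvGen_of_parallel (hX : IsQuasiMedian X) {a b : V} (hab : X.Adj a b)
    (n : ℕ) : ∀ {x y : V}, X.Adj x y → X.dist a x = n → X.dist b x = n + 1 → X.dist b y = n →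
      X.dist a y = n + 1 → Relation.EqvGen (SideRel X) s(a, b) s(x, y) := by
  have hc := hX.connected
  induction n with
  | zero =>
    intro x y _ h1 _ h2 _
    rw [hc.dist_eq_zero_iff] at h1 h2
    subst h1 h2
    exact Relation.EqvGen.refl _
  | succ n ih =>
    intro x y hxy h1 h2 h3 h4
    obtain ⟨x', hx', hax'⟩ := exists_adj_dist_eq hc h1
    have hbx' := dist_le_of_adj hc hx'.symm b
    have hbx'' : X.dist b x' ≤ X.dist b a + X.dist a x' := hc.dist_triangle
    rw [SimpleGraph.dist_eq_one_iff_adj.2 hab.symm] at hbx''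
    obtain ⟨y', hy'x', hy'y, hby'⟩ := hX.quadrangle (u := b) (z := x) (v := x') (w := y)
      hx'.symm hxy
      (fun h => by
        have := dist_le_of_adj hc h.symm a
        omega)
      (by rintro rfl; omega) (by omega) (by omega)
    have hay' : X.dist a y' ≤ X.dist a b + X.dist b y' := hc.dist_triangle
    rw [SimpleGraph.dist_eq_one_iff_adj.2 hab] at hay'
    have hay'' := dist_le_of_adj hc hy'y.symm a
    refine (ih hy'x'.symm hax' (by omega) (by omega) (by omega)).trans _ _ _
      (Relation.EqvGen.rel _ _ (Or.inr ⟨x', y', x, y, hy'x'.symm, hxy, hx', hy'y, ?_, ?_, rfl,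
        rfl⟩))
    · rintro rfl
      omega
    · rintro rfl
      omega

theorem IsQuasiMedian.eqvGen_of_mem_edgeClique (hX : IsQuasiMedian X) {a b c d : V}
    (hab : X.Adj a b) (hc : c ∈ edgeClique X a b) (hd : d ∈ edgeClique X a b) (hcd : c ≠ d) :
    Relation.EqvGen (SideRel X) s(a, b) s(c, d) := by
  have key : ∀ e ∈ edgeClique X a b, a ≠ e → Relation.EqvGen (SideRel X) s(a, b) s(a, e) := by
    intro e he hae
    by_cases hbe : b = e
    · exact hbe ▸ Relation.EqvGen.refl _
    · exact Relation.EqvGen.rel _ _ (Or.inl ⟨a, b, e, hab,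
        hX.adj_of_mem_edgeClique hab (left_mem_edgeClique a b) he hae,
        hX.adj_of_mem_edgeClique hab (right_mem_edgeClique a b) he hbe, rfl, rfl⟩)
  by_cases hac : a = c
  · exact hac ▸ key d hd (hac ▸ hcd)
  by_cases had : a = d
  · rw [Sym2.eq_swap (a := c)]
    exact had ▸ key c hc hac
  refine (key c hc hac).trans _ _ _ (Relation.EqvGen.rel _ _ (Or.inl ⟨c, a, d, ?_, ?_, ?_,
    Sym2.eq_swap, rfl⟩))
  · exact (hX.adj_of_mem_edgeClique hab (left_mem_edgeClique a b) hc hac).symm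
  · exact hX.adj_of_mem_edgeClique hab hc hd hcd
  · exact hX.adj_of_mem_edgeClique hab (left_mem_edgeClique a b) hd had

/-- An edge whose endpoints have different gates in a clique is dual to its hyperplane. -/
theorem IsQuasiMedian.mem_hypClass_of_gates_ne (hX : IsQuasiMedian X) {a b x y c d : V}
    (hab : X.Adj a b) (hxy : X.Adj x y) (hc : IsGate X (edgeClique X a b) x c)
    (hd : IsGate X (edgeClique X a b) y d) (hcd : c ≠ d) : s(x, y) ∈ hypClass X s(a, b) := by
  have h1 := hX.dist_eq_of_isGate_edgeClique hab hc hd.1 hcd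
  have h2 := hX.dist_eq_of_isGate_edgeClique hab hd hc.1 hcd.symm
  have h3 := hX.dist_gate_eq hab hxy hc hd hcd
  rw [SimpleGraph.dist_comm] at h1 h2
  rw [X.dist_comm (u := y)] at h3
  exact (hX.eqvGen_of_mem_edgeClique hab hc.1 hd.1 hcd).trans _ _ _
    (hX.eqvGen_of_parallel (hX.adj_of_mem_edgeClique hab hc.1 hd.1 hcd) (X.dist x c) hxy
      SimpleGraph.dist_comm h1 h3.symm (by rw [h2, h3, SimpleGraph.dist_comm]))

/-- A vertex has at most one neighbor in each other sector of a clique. -/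
theorem IsQuasiMedian.eq_of_gates_eq (hX : IsQuasiMedian X) {a b x s s' c d : V}
    (hab : X.Adj a b) (hxs : X.Adj x s) (hxs' : X.Adj x s') (hx : IsGate X (edgeClique X a b) x d)
    (hs : IsGate X (edgeClique X a b) s c) (hs' : IsGate X (edgeClique X a b) s' c)
    (hdc : d ≠ c) : s = s' := by
  have hc := hX.connected
  have e1 := hX.dist_eq_of_isGate_edgeClique hab hx hs.1 hdc
  have e2 := hX.dist_eq_of_isGate_edgeClique hab hs hx.1 hdc.symm
  have e3 := hX.dist_eq_of_isGate_edgeClique hab hs' hx.1 hdc.symm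
  have e4 := hX.dist_gate_eq hab hxs hx hs hdc
  have e5 := hX.dist_gate_eq hab hxs' hx hs' hdc
  have hdc' := hX.adj_of_mem_edgeClique hab hx.1 hs.1 hdc
  simp only [X.dist_comm (v := c), X.dist_comm (v := d)] at e1 e2 e3 e4 e5
  by_contra hne
  by_cases hadj : X.Adj s s'
  · exact hX.false_of_level_edge (u := c) hadj hxs hxs' (by omega) (by omega)
  obtain ⟨t, hts, hts', ht⟩ := hX.quadrangle (u := c) hxs hxs' hadj hne (by omega) (by omega)
  have f1 := dist_le_of_adj hc hts.symm d
  have f2 : X.dist d t ≤ X.dist d c + X.dist c t := hc.dist_triangle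
  rw [SimpleGraph.dist_eq_one_iff_adj.2 hdc'] at f2
  have hxt : ¬ X.Adj x t := fun h => by
    have := dist_le_of_adj hc h c
    omega
  have hxt' : x ≠ t := by
    rintro rfl
    omega
  obtain ⟨w, hwx, hwt, hw⟩ := hX.quadrangle (u := d) hxs.symm hts.symm hxt hxt' (by omega)
    (by omega)
  refine hxt' (hX.eq_of_common_neighbors hxs.symm hxs'.symm hwx hts.symm hts'.symm hwt ?_ ?_ ?_)
  · exact dist_eq_two hc hne hadj hxs.symm hxs'
  · refine dist_eq_two hc ?_ ?_ hxs.symm hwx.symm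
    · rintro rfl
      omega
    · intro h
      have := dist_le_of_adj hc h d
      omega
  · refine dist_eq_two hc ?_ ?_ hxs'.symm hwx.symm
    · rintro rfl
      omega
    · intro h
      have := dist_le_of_adj hc h d
      omega

/-- The endpoints of `e` have different gates in the set `S`. -/
def GatesDiffer (X : SimpleGraph V) (S : Set V) (e : Sym2 V) : Prop :=
  ∀ x y c : V, e = s(x, y) → IsGate X S x c → ¬ IsGate X S y c

theorem gatesDiffer_of_ne (hc : X.Connected) {S : Set V} {x y c d : V} (hx : IsGate X S x c)
    (hy : IsGate X S y d) (hcd : c ≠ d) : GatesDiffer X S s(x, y) := by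
  intro x' y' e he hx' hy'
  rcases Sym2.eq_iff.1 he with ⟨rfl, rfl⟩ | ⟨rfl, rfl⟩
  · exact hcd ((hx.eq hc hx').trans (hy.eq hc hy').symm)
  · exact hcd ((hx.eq hc hy').trans (hy.eq hc hx').symm)

/-- The endpoints of an edge parallel to an edge crossing between sectors lie in different
sectors. -/
theorem IsQuasiMedian.gates_ne_of_square (hX : IsQuasiMedian X) {a b x y x' y' c d e : V}
    (hab : X.Adj a b) (hxy : X.Adj x y) (hxy' : X.Adj x' y') (hxx' : X.Adj x x')
    (hyy' : X.Adj y y') (h1 : x ≠ y') (h2 : y ≠ x') (hx : IsGate X (edgeClique X a b) x c)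
    (hy : IsGate X (edgeClique X a b) y d) (hcd : c ≠ d)
    (hx' : IsGate X (edgeClique X a b) x' e) (hy' : IsGate X (edgeClique X a b) y' e) :
    False := by
  have hc := hX.connected
  by_cases hec : e = c
  · subst hec
    exact h1 (hX.eq_of_gates_eq hab hxy.symm hyy' hy hx hy' hcd.symm)
  by_cases hed : e = d
  · subst hed
    exact h2 (hX.eq_of_gates_eq hab hxy hxx' hx hy hx' hcd)
  have i1 := hX.dist_gate_eq hab hxy hx hy hcd
  have i2 := hX.dist_gate_eq hab hxx' hx hx' (Ne.symm hec)
  have i3 := hX.dist_gate_eq hab hyy' hy hy' (Ne.symm hed)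
  have j1 := hX.dist_eq_of_isGate_edgeClique hab hx hx'.1 (Ne.symm hec)
  have j2 := hX.dist_eq_of_isGate_edgeClique hab hy hx'.1 (Ne.symm hed)
  obtain ⟨s, hsx, hsy, hs⟩ := hX.triangle (u := e) hxy (by
    rw [X.dist_comm (u := e), X.dist_comm (u := e)]
    omega)
  rw [X.dist_comm (u := e), X.dist_comm (u := e)] at hs
  obtain ⟨g, hg⟩ := hX.isGated_edgeClique hab s
  have hge : g = e := by
    by_contra hge
    have k1 := hX.dist_eq_of_isGate_edgeClique hab hg hx'.1 hge
    by_cases hgc : g = c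
    · have := hX.dist_gate_eq hab hsy hg hy (hgc ▸ hcd)
      omega
    · have := hX.dist_gate_eq hab hsx hg hx hgc
      omega
  subst hge
  have l1 := hX.eq_of_gates_eq hab hsx.symm hxx' hx hg hx' (Ne.symm hec)
  have l2 := hX.eq_of_gates_eq hab hsy.symm hyy' hy hg hy' (Ne.symm hed)
  exact hxy'.ne (l1.symm.trans l2)

theorem IsQuasiMedian.gatesDiffer_of_sideRel (hX : IsQuasiMedian X) {a b : V} (hab : X.Adj a b)
    {e f : Sym2 V} (hef : SideRel X e f) (he : GatesDiffer X (edgeClique X a b) e) :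
    GatesDiffer X (edgeClique X a b) f := by
  have hc := hX.connected
  have hgate := hX.isGated_edgeClique hab
  rcases hef with ⟨x, y, z, hxy, hxz, hyz, rfl, rfl⟩ | ⟨x, y, x', y', hxy, hxy', hxx', hyy', h1,
    h2, rfl, rfl⟩
  · obtain ⟨c, hx⟩ := hgate x
    obtain ⟨d, hy⟩ := hgate y
    obtain ⟨e, hz⟩ := hgate z
    have hcd : c ≠ d := by
      rintro rfl
      exact he x y c rfl hx hy
    refine gatesDiffer_of_ne hc hx hz ?_
    rintro rfl
    exact hxz.ne (hX.eq_of_gates_eq hab hxy.symm hyz hy hx hz hcd.symm)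
  · obtain ⟨c, hx⟩ := hgate x
    obtain ⟨d, hy⟩ := hgate y
    obtain ⟨e, hx'⟩ := hgate x'
    obtain ⟨f, hy'⟩ := hgate y'
    have hcd : c ≠ d := by
      rintro rfl
      exact he x y c rfl hx hy
    refine gatesDiffer_of_ne hc hx' hy' ?_
    rintro rfl
    exact hX.gates_ne_of_square hab hxy hxy' hxx' hyy' h1 h2 hx hy hcd hx' hy'

theorem IsQuasiMedian.gatesDiffer_of_mem_hypClass (hX : IsQuasiMedian X) {a b : V}
    (hab : X.Adj a b) {f : Sym2 V} (hf : f ∈ hypClass X s(a, b)) :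
    GatesDiffer X (edgeClique X a b) f := by
  have key : ∀ e f, Relation.EqvGen (SideRel X) e f →
      (GatesDiffer X (edgeClique X a b) e ↔ GatesDiffer X (edgeClique X a b) f) := by
    intro e f h
    induction h with
    | rel e f h =>
      exact ⟨hX.gatesDiffer_of_sideRel hab h, hX.gatesDiffer_of_sideRel hab h.symm⟩
    | refl e => exact Iff.rfl
    | symm e f _ ih => exact ih.symm
    | trans e f g _ _ ih1 ih2 => exact ih1.trans ih2
  refine (key _ _ hf).1 ?_
  exact gatesDiffer_of_ne hX.connected
    (hX.isGate_edgeClique hab (left_mem_edgeClique a b) (by simp))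
    (hX.isGate_edgeClique hab (right_mem_edgeClique a b) (by simp)) hab.ne

/-! ### Separation by hyperplanes -/

theorem hypClass_eq_of_mem {e f : Sym2 V} (h : f ∈ hypClass X e) :
    hypClass X f = hypClass X e :=
  Set.ext fun _ => ⟨fun hg => h.trans _ _ _ hg, fun hg => (h.symm _ _).trans _ _ _ hg⟩

theorem Hyperplane.eq_hypClass (J : Hyperplane X) {e : Sym2 V} (he : e ∈ J.1) :
    J.1 = hypClass X e := by
  obtain ⟨e₀, -, h⟩ := J.2
  rw [h] at he ⊢
  exact (hypClass_eq_of_mem he).symm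

theorem Hyperplane.mem_of_sideRel (J : Hyperplane X) {e f : Sym2 V} (he : e ∈ J.1)
    (h : SideRel X e f) : f ∈ J.1 := by
  rw [J.eq_hypClass he]
  exact Relation.EqvGen.rel _ _ h

theorem not_separates_iff {H : Set (Sym2 V)} {p q : V} :
    ¬ Separates X H p q ↔ ∃ w : X.Walk p q, ∀ e ∈ w.edges, e ∉ H := by
  simp [Separates]

theorem not_separates_refl (H : Set (Sym2 V)) (p : V) : ¬ Separates X H p p :=
  not_separates_iff.2 ⟨SimpleGraph.Walk.nil, by simp⟩

theorem not_separates_symm {H : Set (Sym2 V)} {p q : V} (h : ¬ Separates X H p q) :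
    ¬ Separates X H q p := by
  rw [not_separates_iff] at *
  obtain ⟨w, hw⟩ := h
  exact ⟨w.reverse, by simpa using hw⟩

theorem not_separates_trans {H : Set (Sym2 V)} {p q r : V} (h₁ : ¬ Separates X H p q)
    (h₂ : ¬ Separates X H q r) : ¬ Separates X H p r := by
  rw [not_separates_iff] at *
  obtain ⟨w₁, hw₁⟩ := h₁
  obtain ⟨w₂, hw₂⟩ := h₂
  refine ⟨w₁.append w₂, fun e he => ?_⟩
  rw [SimpleGraph.Walk.edges_append, List.mem_append] at he
  exact he.elim (hw₁ e) (hw₂ e)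

theorem not_separates_of_adj {H : Set (Sym2 V)} {p q : V} (h : X.Adj p q) (hH : s(p, q) ∉ H) :
    ¬ Separates X H p q :=
  not_separates_iff.2 ⟨SimpleGraph.Walk.cons h SimpleGraph.Walk.nil, by simpa using hH⟩

theorem IsQuasiMedian.separates_of_gates_ne (hX : IsQuasiMedian X) {a b v p c d : V}
    (hab : X.Adj a b) (hv : IsGate X (edgeClique X a b) v c)
    (hp : IsGate X (edgeClique X a b) p d) (hcd : c ≠ d) :
    Separates X (hypClass X s(a, b)) v p := by
  intro w
  induction w generalizing c with
  | nil => exact absurd (hv.eq hX.connected hp) hcd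
  | @cons v v' p h w ih =>
    obtain ⟨c', hv'⟩ := hX.isGated_edgeClique hab v'
    by_cases hcc : c = c'
    · obtain ⟨e, he, heJ⟩ := ih (hcc ▸ hv') hp hcd
      exact ⟨e, by simp [he], heJ⟩
    · exact ⟨s(v, v'), by simp, hX.mem_hypClass_of_gates_ne hab h hv hv' hcc⟩

theorem IsQuasiMedian.isGate_left (hX : IsQuasiMedian X) {a b v : V} (hab : X.Adj a b)
    (h : X.dist v a < X.dist v b) : IsGate X (edgeClique X a b) v a := by
  obtain ⟨c, hc⟩ := hX.isGated_edgeClique hab v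
  by_cases hca : c = a
  · exact hca ▸ hc
  have h1 := hX.dist_eq_of_isGate_edgeClique hab hc (left_mem_edgeClique a b) hca
  have h2 := hc.2 b (right_mem_edgeClique a b)
  by_cases hcb : c = b
  · subst hcb
    omega
  have h3 := hX.dist_eq_of_isGate_edgeClique hab hc (right_mem_edgeClique a b) hcb
  omega

theorem IsQuasiMedian.isGate_right (hX : IsQuasiMedian X) {a b v : V} (hab : X.Adj a b)
    (h : X.dist v b < X.dist v a) : IsGate X (edgeClique X a b) v b := by
  have hgate := hX.isGate_left hab.symm h
  have hS : edgeClique X b a = edgeClique X a b := by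
    ext c
    simp only [edgeClique, Set.mem_ofPred_eq]
    tauto
  rwa [hS] at hgate

/-- A hyperplane dual to an edge of a geodesic separates the endpoints of this geodesic. -/
theorem IsQuasiMedian.separates_of_geodesic_edge (hX : IsQuasiMedian X) (J : Hyperplane X)
    {a b v p : V} (hab : X.Adj a b) (hJ : s(a, b) ∈ J.1) (hv : X.dist v a < X.dist v b)
    (hp : X.dist p b < X.dist p a) : Separates X J.1 v p := by
  rw [J.eq_hypClass hJ]
  exact hX.separates_of_gates_ne hab (hX.isGate_left hab hv) (hX.isGate_right hab hp) hab.ne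

theorem exists_geodesic_edge (hc : X.Connected) {H : Set (Sym2 V)} {x y : V}
    (h : Separates X H x y) :
    ∃ a b, X.Adj a b ∧ s(a, b) ∈ H ∧ X.dist x a + 1 + X.dist b y = X.dist x y := by
  obtain ⟨n, hn⟩ : ∃ n, X.dist x y = n := ⟨_, rfl⟩
  induction n generalizing y with
  | zero =>
    rw [hc.dist_eq_zero_iff] at hn
    subst hn
    exact absurd h (not_separates_refl H x)
  | succ n ih =>
    obtain ⟨y', hy'y, hxy'⟩ := exists_adj_dist_eq hc hn
    by_cases hH : s(y', y) ∈ H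
    · exact ⟨y', y, hy'y, hH, by simp [hxy', hn]⟩
    have h' : Separates X H x y' := by
      by_contra h'
      exact not_separates_trans h' (not_separates_of_adj hy'y hH) h
    obtain ⟨a, b, hab, hJ, hd⟩ := ih h' hxy'
    refine ⟨a, b, hab, hJ, ?_⟩
    have h1 := dist_le_of_adj hc hy'y.symm b
    have h2 : X.dist x y ≤ X.dist x b + X.dist b y := hc.dist_triangle
    have h3 := dist_le_of_adj hc hab.symm x
    omega

/-- A geodesic crosses a hyperplane at most once. -/
theorem IsQuasiMedian.not_separates_of_geodesic (hX : IsQuasiMedian X) (J : Hyperplane X)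
    {x y z : V} (hd : X.dist x y + X.dist y z = X.dist x z) (hxy : Separates X J.1 x y) :
    ¬ Separates X J.1 y z := by
  intro hyz
  have hc := hX.connected
  obtain ⟨a, b, hab, hJ, h1⟩ := exists_geodesic_edge hc hxy
  obtain ⟨c, d, hcd, hJ', h2⟩ := exists_geodesic_edge hc hyz
  have t1 : X.dist x z ≤ X.dist x a + X.dist a z := hc.dist_triangle
  have t2 : X.dist a z ≤ X.dist a c + X.dist c z := hc.dist_triangle
  have t3 : X.dist b c ≤ X.dist b y + X.dist y c := hc.dist_triangle
  have t4 : X.dist a z ≤ X.dist a d + X.dist d z := hc.dist_triangle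
  have t5 : X.dist b d ≤ X.dist b y + X.dist y d := hc.dist_triangle
  have t6 : X.dist y d ≤ X.dist y c + 1 := dist_le_of_adj hc hcd.symm y
  have t7 : X.dist c z ≤ X.dist d z + 1 := by
    have := dist_le_of_adj hc hcd z
    rwa [X.dist_comm (u := z), X.dist_comm (u := z)] at this
  rw [J.eq_hypClass hJ] at hJ'
  refine hX.gatesDiffer_of_mem_hypClass hab hJ' c d b rfl (hX.isGate_right hab ?_)
    (hX.isGate_right hab ?_)
  all_goals
    rw [SimpleGraph.dist_comm, X.dist_comm (v := a)]
    omega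

theorem IsQuasiMedian.separates_of_adj (hX : IsQuasiMedian X) (J : Hyperplane X) {a b : V}
    (hab : X.Adj a b) (hJ : s(a, b) ∈ J.1) : Separates X J.1 a b := by
  have h := SimpleGraph.dist_eq_one_iff_adj.2 hab
  have h' := SimpleGraph.dist_eq_one_iff_adj.2 hab.symm
  exact hX.separates_of_geodesic_edge J hab hJ (by simp [h]) (by simp [h'])

/-! ### A local criterion for gatedness -/

theorem IsQuasiMedian.isGated_of_local (hX : IsQuasiMedian X) {T : Set V}
    (hconn : (X.induce T).Connected)
    (htri : ∀ x ∈ T, ∀ y ∈ T, ∀ z, X.Adj x y → X.Adj z x → X.Adj z y → z ∈ T)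
    (hsq : ∀ a ∈ T, ∀ b ∈ T, ∀ c ∈ T, ∀ x, X.Adj b a → X.Adj b c → a ≠ c → ¬ X.Adj a c →
      X.Adj x a → X.Adj x c → b ≠ x → x ∈ T) : IsGated X T := by
  have hc := hX.connected
  intro v
  obtain ⟨⟨t, ht⟩⟩ := hconn.nonempty
  obtain ⟨w, hwT, hw⟩ := exists_nearest (X := X) T ⟨t, ht⟩ v
  have key : ∀ n (q : T), (X.induce T).dist ⟨w, hwT⟩ q = n → X.dist v q = X.dist v w + n := by
    intro n
    induction n using Nat.strong_induction_on with
    | _ n ih =>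
    intro q hq
    cases n with
    | zero =>
      rw [hconn.dist_eq_zero_iff] at hq
      simp [← hq]
    | succ n =>
      obtain ⟨q', hq'q, hq'⟩ := exists_adj_dist_eq hconn hq
      have adj' : X.Adj (q' : V) q := hq'q
      have e' := ih n (by omega) q' hq'
      have b1 := dist_le_of_adj hc adj' v
      have b2 := dist_le_of_adj hc adj'.symm v
      have hdown : ∀ x : T, X.Adj (q' : V) x → (X.induce T).dist ⟨w, hwT⟩ x = n + 1 →
          X.dist v q' ≠ X.dist v x + 1 := by
        intro x hx hdx hvx
        have hxw := hw x x.2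
        cases n with
        | zero => omega
        | succ m =>
          obtain ⟨q'', hq''q', hq''⟩ := exists_adj_dist_eq hconn hq'
          have adj'' : X.Adj (q'' : V) q' := hq''q'
          have e'' := ih m (by omega) q'' hq''
          have hna : ¬ X.Adj (q'' : V) x := by
            intro h
            have h' : (X.induce T).Adj q'' x := h
            have := dist_le_of_adj hconn h'.symm ⟨w, hwT⟩
            omega
          have hne : (q'' : V) ≠ x := by
            intro h
            rw [Subtype.ext h] at hq''
            omega
          obtain ⟨y, hyq'', hyx, hy⟩ := hX.quadrangle (u := v) adj''.symm hx hna hne (by omega)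
            (by omega)
          have hyT : y ∈ T := by
            refine hsq q'' q''.2 q' q'.2 x x.2 y adj''.symm hx hne hna hyq'' hyx ?_
            rintro rfl
            omega
          have g1 : (X.induce T).Adj ⟨y, hyT⟩ q'' := hyq''
          have g2 : (X.induce T).Adj ⟨y, hyT⟩ x := hyx
          have d1 := dist_le_of_adj hconn g1 ⟨w, hwT⟩
          have d2 := dist_le_of_adj hconn g2.symm ⟨w, hwT⟩
          have := ih (m + 1) (by omega) ⟨y, hyT⟩ (by omega)
          simp only at this
          omega
      have h1 := hdown q adj' hq
      by_contra hne
      obtain ⟨x, hxq', hxq, hx⟩ := hX.triangle (u := v) adj' (by omega)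
      have hxT : x ∈ T := htri q' q'.2 q q.2 x adj' hxq' hxq
      have g1 : (X.induce T).Adj ⟨x, hxT⟩ q' := hxq'
      have g2 : (X.induce T).Adj ⟨x, hxT⟩ q := hxq
      have d1 := dist_le_of_adj hconn g1 ⟨w, hwT⟩
      have d2 := dist_le_of_adj hconn g2.symm ⟨w, hwT⟩
      refine hdown ⟨x, hxT⟩ hxq'.symm ?_ (by simp only; omega)
      by_contra hdx
      have := ih n (by omega) ⟨x, hxT⟩ (by omega)
      simp only at this
      omega
  refine ⟨w, hwT, fun q hq => ?_⟩
  have h1 := key _ ⟨q, hq⟩ rfl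
  have h2 : X.dist w q ≤ (X.induce T).dist ⟨w, hwT⟩ ⟨q, hq⟩ := by
    obtain ⟨p, hp⟩ := hconn.exists_walk_length_eq_dist ⟨w, hwT⟩ ⟨q, hq⟩
    rw [← hp]
    have := SimpleGraph.dist_le (p.map (SimpleGraph.Embedding.induce T).toHom)
    rwa [SimpleGraph.Walk.length_map] at this
  have h3 : X.dist v q ≤ X.dist v w + X.dist w q := hc.dist_triangle
  simp only at h1
  omega

theorem reachable_induce_of_interval (hc : X.Connected) {T : Set V} {v p : V} (hv : v ∈ T)
    (hp : p ∈ T) (h : ∀ u, X.dist v u + X.dist u p = X.dist v p → u ∈ T) :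
    (X.induce T).Reachable ⟨v, hv⟩ ⟨p, hp⟩ := by
  obtain ⟨n, hn⟩ : ∃ n, X.dist v p = n := ⟨_, rfl⟩
  induction n generalizing p with
  | zero =>
    rw [hc.dist_eq_zero_iff] at hn
    subst hn
    exact SimpleGraph.Reachable.refl _
  | succ n ih =>
    obtain ⟨p', hp'p, hvp'⟩ := exists_adj_dist_eq hc hn
    have hd := SimpleGraph.dist_eq_one_iff_adj.2 hp'p
    have hp'T : p' ∈ T := h p' (by omega)
    have hadj : (X.induce T).Adj ⟨p', hp'T⟩ ⟨p, hp⟩ := hp'p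
    refine (ih hp'T (fun u hu => h u ?_) hvp').trans hadj.reachable
    have h1 : X.dist v p ≤ X.dist v u + X.dist u p := hc.dist_triangle
    have h2 := dist_le_of_adj hc hp'p.symm u
    omega

theorem IsGated.isConvexSet (hc : X.Connected) {S : Set V} (hS : IsGated X S) :
    IsConvexSet X S := by
  intro x hx y hy z hz
  obtain ⟨g, hg, hgate⟩ := hS z
  have h1 := hgate x hx
  have h2 := hgate y hy
  have h3 : X.dist x y ≤ X.dist x g + X.dist g y := hc.dist_triangle
  rw [X.dist_comm (u := x)] at hz
  rw [X.dist_comm (u := x) (v := g)] at h3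
  have : z = g := hc.dist_eq_zero_iff.1 (by omega)
  exact this ▸ hg

/-! ### The extension of a gated subgraph by a collection of hyperplanes -/

theorem subset_gatedExtension (S : Set V) (ℋ : Set (Hyperplane X)) :
    S ⊆ gatedExtension X S ℋ :=
  fun v hv => ⟨v, hv, fun H hH => absurd hH (not_separates_refl H.1 v)⟩

/-- A vertex belongs to the extension if and only if no hyperplane outside `ℋ` separates it
from all of `S`. -/
theorem IsQuasiMedian.mem_gatedExtension_iff (hX : IsQuasiMedian X) {S : Set V}
    (hS : IsGated X S) (ℋ : Set (Hyperplane X)) (v : V) :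
    v ∈ gatedExtension X S ℋ ↔ ∀ J ∉ ℋ, ∃ p ∈ S, ¬ Separates X J.1 v p := by
  constructor
  · rintro ⟨p, hp, h⟩ J hJ
    exact ⟨p, hp, fun hsep => hJ (h J hsep)⟩
  · intro h
    obtain ⟨g, hg, hgate⟩ := hS v
    refine ⟨g, hg, fun J hJ => ?_⟩
    by_contra hJH
    obtain ⟨q, hq, hvq⟩ := h J hJH
    exact not_separates_trans hvq
      (not_separates_symm (hX.not_separates_of_geodesic J (hgate q hq) hJ)) hJ

/-- A hyperplane separating two vertices of a gated set `S` separates no vertex from all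
of `S`. -/
theorem IsQuasiMedian.exists_not_separates (hX : IsQuasiMedian X) {S : Set V}
    (hS : IsGated X S) (J : Hyperplane X) {p q : V} (hp : p ∈ S) (hq : q ∈ S)
    (h : Separates X J.1 p q) (v : V) : ∃ g ∈ S, ¬ Separates X J.1 v g := by
  obtain ⟨g, hg, hgate⟩ := hS v
  refine ⟨g, hg, fun hvg => ?_⟩
  exact not_separates_trans
    (not_separates_symm (hX.not_separates_of_geodesic J (hgate p hp) hvg))
    (hX.not_separates_of_geodesic J (hgate q hq) hvg) h

theorem IsQuasiMedian.gatedExtension_step (hX : IsQuasiMedian X) {S : Set V}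
    (hS : IsGated X S) {ℋ : Set (Hyperplane X)} {a b c d x : V}
    (ha : a ∈ gatedExtension X S ℋ) (hb : b ∈ gatedExtension X S ℋ)
    (hc : c ∈ gatedExtension X S ℋ) (hd : d ∈ gatedExtension X S ℋ) (hxa : X.Adj x a)
    (hxb : X.Adj x b) (hcd : X.Adj c d)
    (h : ∀ J : Hyperplane X, s(x, a) ∈ J.1 → s(x, b) ∈ J.1 → s(c, d) ∈ J.1) :
    x ∈ gatedExtension X S ℋ := by
  rw [hX.mem_gatedExtension_iff hS] at *
  intro J hJ
  by_cases ja : s(x, a) ∈ J.1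
  · by_cases jb : s(x, b) ∈ J.1
    · obtain ⟨p, hp, hcp⟩ := hc J hJ
      obtain ⟨q, hq, hdq⟩ := hd J hJ
      refine hX.exists_not_separates hS J hp hq (by_contra fun hpq => ?_) x
      exact not_separates_trans hcp (not_separates_trans hpq (not_separates_symm hdq))
        (hX.separates_of_adj J hcd (h J ja jb))
    · obtain ⟨p, hp, hbp⟩ := hb J hJ
      exact ⟨p, hp, not_separates_trans (not_separates_of_adj hxb jb) hbp⟩
  · obtain ⟨p, hp, hap⟩ := ha J hJ
    exact ⟨p, hp, not_separates_trans (not_separates_of_adj hxa ja) hap⟩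

theorem IsQuasiMedian.induce_gatedExtension_connected (hX : IsQuasiMedian X) {S : Set V}
    (hS : IsGated X S) (ℋ : Set (Hyperplane X)) :
    (X.induce (gatedExtension X S ℋ)).Connected := by
  have hc := hX.connected
  obtain ⟨o⟩ := hc.nonempty
  obtain ⟨s, hs, -⟩ := hS o
  have hsub := subset_gatedExtension (X := X) S ℋ
  refine (SimpleGraph.connected_iff_exists_forall_reachable _).2 ⟨⟨s, hsub hs⟩, ?_⟩
  rintro ⟨v, hv⟩
  obtain ⟨p, hp, h⟩ := hv
  have h1 : (X.induce (gatedExtension X S ℋ)).Reachable ⟨s, hsub hs⟩ ⟨p, hsub hp⟩ :=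
    reachable_induce_of_interval hc (hsub hs) (hsub hp)
      fun u hu => hsub (hS.isConvexSet hc s hs p hp u hu)
  refine h1.trans (SimpleGraph.Reachable.symm ?_)
  refine reachable_induce_of_interval (T := gatedExtension X S ℋ) hc ⟨p, hp, h⟩ (hsub hp)
    fun u hu => ⟨p, hp, ?_⟩
  intro J hJ
  obtain ⟨a, b, hab, hJab, hd⟩ := exists_geodesic_edge hc hJ
  have t1 : X.dist v p ≤ X.dist v b + X.dist b p := hc.dist_triangle
  have t2 : X.dist v a ≤ X.dist v u + X.dist u a := hc.dist_triangle
  have t3 : X.dist u p ≤ X.dist u a + X.dist a p := hc.dist_triangle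
  refine h J (hX.separates_of_geodesic_edge J hab hJab (by omega) ?_)
  rw [X.dist_comm (u := p), X.dist_comm (u := p)]
  omega

end QuasiMedian

/-- **Lemma.** If `Y` is a gated (full) subgraph of a quasi-median graph `X` and `ℋ` is any
collection of hyperplanes of `X`, then the subgraph `Y_ℋ` is gated. -/
theorem gatedExtension_isGated {V : Type*} (X : SimpleGraph V) (hX : IsQuasiMedian X)
    (S : Set V) (hS : IsGated X S) (ℋ : Set (Hyperplane X)) :
    IsGated X (gatedExtension X S ℋ) := by
  refine hX.isGated_of_local (hX.induce_gatedExtension_connected hS ℋ) ?_ ?_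
  · intro x hx y hy z hxy hzx hzy
    refine hX.gatedExtension_step hS hx hy hx hy hzx hzy hxy fun J hJ _ => ?_
    exact J.mem_of_sideRel hJ (Or.inl ⟨x, z, y, hzx.symm, hxy, hzy, Sym2.eq_swap, rfl⟩)
  · intro a ha b hb c hc x hba hbc hac _ hxa hxc hbx
    refine hX.gatedExtension_step hS ha hc hb hc hxa hxc hbc fun J hJ _ => ?_
    exact J.mem_of_sideRel hJ (Or.inr ⟨x, a, c, b, hxa, hbc.symm, hxc, hba.symm, hbx.symm, hac,
      rfl, Sym2.eq_swap⟩)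

end QM
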